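/- Let X and Y be measurable spaces, let D be a probability measure on X × Y, and let g, g_1, ..., g_m : X → Y (m ≥ 1) be functions such that each disagreement set {(x,y) : h(x) ≠ y} (for h ∈ {g, g_1, ..., g_m}) is measurable. Fix ε ∈ (0,1]. Suppose that (i) strictly more than 70% of the indices i ∈ {1,...,m} satisfy err_D(g_i) ≤ ε/4 (such g_i are called good candidates for D), and (ii) g has the plurality property with respect to g_1,...,g_m: for every x ∈ X and y ∈ Y with g(x) ≠ y, the number of indices i with g_i(x) ≠ y is at least m/2 (this property holds for any plurality vote of g_1,...,g_m). Then err_D(g) ≤ ε. -/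

import Mathlib

open MeasureTheory
open scoped Classical

/-- Plurality vote accuracy: if strictly more than 70% of the functions `gs i`
are good candidates for `D` (error at most `ε/4`), and `g` has the plurality
property with respect to the `gs i`, then `err_D(g) ≤ ε`. -/
theorem plurality_error_bound
    {X Y : Type*} [MeasurableSpace X] [MeasurableSpace Y]
    (D : Measure (X × Y)) [IsProbabilityMeasure D]
    (m : ℕ) (hm : 1 ≤ m)
    (g : X → Y) (gs : Fin m → X → Y)
    (hg : MeasurableSet {p : X × Y | g p.1 ≠ p.2})
    (hgs : ∀ i, MeasurableSet {p : X × Y | gs i p.1 ≠ p.2})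
    (ε : ℝ) (hε : 0 < ε) (hε1 : ε ≤ 1)
    (hgood : (0.7 : ℝ) * m <
      ((Finset.univ.filter
        (fun i : Fin m => (D {p : X × Y | gs i p.1 ≠ p.2}).toReal ≤ ε / 4)).card : ℝ))
    (hplur : ∀ x y, g x ≠ y →
      (m : ℝ) / 2 ≤ ((Finset.univ.filter (fun i : Fin m => gs i x ≠ y)).card : ℝ)) :
    (D {p : X × Y | g p.1 ≠ p.2}).toReal ≤ ε := by
  set G := Finset.univ.filter
        (fun i : Fin m => (D {p : X × Y | gs i p.1 ≠ p.2}).toReal ≤ ε / 4) with hG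
  set k : ℝ := (G.card : ℝ) with hk
  have hm' : (1 : ℝ) ≤ m := by exact_mod_cast hm
  have hpt : ∀ p : X × Y, (k - m / 2) * ({p : X × Y | g p.1 ≠ p.2}.indicator (fun _ => (1 : ℝ)) p)
      ≤ ∑ i ∈ G, {p : X × Y | gs i p.1 ≠ p.2}.indicator (fun _ => (1 : ℝ)) p := by
    intro p
    by_cases hp : g p.1 ≠ p.2
    · have h1 := hplur p.1 p.2 hp
      have h2 : (Finset.univ.filter (fun i : Fin m => gs i p.1 ≠ p.2)).card + G.card ≤
          (G.filter (fun i : Fin m => gs i p.1 ≠ p.2)).card + m := by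
        have h3 := Finset.card_union_add_card_inter
          (Finset.univ.filter (fun i : Fin m => gs i p.1 ≠ p.2)) G
        have h4 : (Finset.univ.filter (fun i : Fin m => gs i p.1 ≠ p.2)) ∩ G
            = G.filter (fun i : Fin m => gs i p.1 ≠ p.2) := by
          ext i
          simp only [Finset.mem_inter, Finset.mem_filter, Finset.mem_univ, true_and]
          exact and_comm
        rw [h4] at h3
        have h5 := Finset.card_le_univ
          ((Finset.univ.filter (fun i : Fin m => gs i p.1 ≠ p.2)) ∪ G)
        rw [Fintype.card_fin] at h5
        omega
      have h2' : ((Finset.univ.filter (fun i : Fin m => gs i p.1 ≠ p.2)).card : ℝ) + k ≤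
          ((G.filter (fun i : Fin m => gs i p.1 ≠ p.2)).card : ℝ) + m := by
        rw [hk]; exact_mod_cast h2
      have h6 : ∑ i ∈ G, {p : X × Y | gs i p.1 ≠ p.2}.indicator (fun _ => (1 : ℝ)) p
          = ((G.filter (fun i : Fin m => gs i p.1 ≠ p.2)).card : ℝ) := by
        simp only [Set.indicator_apply, Set.mem_setOf_eq]
        exact Finset.sum_boole _ _
      rw [h6, Set.indicator_of_mem (by exact hp)]
      linarith
    · rw [Set.indicator_of_notMem (by exact hp), mul_zero]
      exact Finset.sum_nonneg fun i _ => Set.indicator_nonneg (fun _ _ => zero_le_one) _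
  have hint : ∀ s : Set (X × Y), MeasurableSet s →
      Integrable (s.indicator (fun _ => (1 : ℝ))) D :=
    fun s hs => (integrable_const (1 : ℝ)).indicator hs
  have hval : ∀ s : Set (X × Y), MeasurableSet s →
      ∫ p, s.indicator (fun _ => (1 : ℝ)) p ∂D = (D s).toReal := by
    intro s hs
    rw [integral_indicator_const _ hs]
    simp [Measure.real]
  have hI := integral_mono ((hint _ hg).const_mul (k - m / 2))
    (integrable_finset_sum G fun i _ => hint _ (hgs i)) hpt
  rw [integral_const_mul, integral_finset_sum G fun i _ => hint _ (hgs i), hval _ hg,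
    Finset.sum_congr rfl fun i _ => hval _ (hgs i)] at hI
  have hS : ∑ i ∈ G, (D {p : X × Y | gs i p.1 ≠ p.2}).toReal ≤ k * (ε / 4) := by
    have := Finset.sum_le_card_nsmul G
      (fun i => (D {p : X × Y | gs i p.1 ≠ p.2}).toReal) (ε / 4)
      (fun i hi => (Finset.mem_filter.mp hi).2)
    rwa [nsmul_eq_mul] at this
  have hpos : 0 < k - m / 2 := by norm_num at hgood; linarith
  have hfin : k * (ε / 4) ≤ (k - m / 2) * ε := by
    norm_num at hgood
    nlinarith
  exact le_of_mul_le_mul_left (hI.trans (hS.trans hfin)) hpos
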